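/- For every k ≠ 0 and every r ∈ ℝ, the second partial derivative with respect to k satisfies ∂²_k S_k(r) = (1/(4k²))·(−3r·C_k(r) + (3 − k·r²)·S_k(r)); moreover, for each fixed r, lim_{k→0} ∂²_k S_k(r) = r⁵/60. -/

import Mathlib

open Real Filter Topology

/-- The function `S_k(r)`: `sin(√k r)/√k` for `k > 0`, `r` for `k = 0`,
and `sinh(√(-k) r)/√(-k)` for `k < 0`. -/
noncomputable def Sk (k r : ℝ) : ℝ :=
  if 0 < k then Real.sin (Real.sqrt k * r) / Real.sqrt k
  else if k = 0 then r
  else Real.sinh (Real.sqrt (-k) * r) / Real.sqrt (-k)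

/-- The function `C_k(r)`: `cos(√k r)` for `k > 0`, `1` for `k = 0`,
and `cosh(√(-k) r)` for `k < 0`. -/
noncomputable def Ck (k r : ℝ) : ℝ :=
  if 0 < k then Real.cos (Real.sqrt k * r)
  else if k = 0 then 1
  else Real.cosh (Real.sqrt (-k) * r)

lemma sqrt_hd {k : ℝ} (hk : 0 < k) (r : ℝ) :
    HasDerivAt (fun κ => Real.sqrt κ * r) (1 / (2 * Real.sqrt k) * r) k :=
  (Real.hasDerivAt_sqrt hk.ne').mul_const r

lemma sqrt_neg_hd {k : ℝ} (hk : k < 0) :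
    HasDerivAt (fun κ => Real.sqrt (-κ)) (-1 / (2 * Real.sqrt (-k))) k :=
  (hasDerivAt_neg k).sqrt (by linarith)

lemma Sk_hd {k : ℝ} (hk : k ≠ 0) (r : ℝ) :
    HasDerivAt (fun κ => Sk κ r) ((r * Ck k r - Sk k r) / (2 * k)) k := by
  rcases lt_or_gt_of_ne hk with h | h
  · have e : (fun κ => Sk κ r) =ᶠ[𝓝 k]
        fun κ => Real.sinh (Real.sqrt (-κ) * r) / Real.sqrt (-κ) := by
      filter_upwards [Iio_mem_nhds h] with κ hκ
      have hκ : κ < 0 := hκ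
      simp [Sk, hκ.not_gt, hκ.ne]
    refine HasDerivAt.congr_of_eventuallyEq ?_ e
    have hs : 0 < Real.sqrt (-k) := Real.sqrt_pos.2 (by linarith)
    have hq : Real.sqrt (-k) ^ 2 = -k := Real.sq_sqrt (by linarith)
    refine ((((sqrt_neg_hd h).mul_const r).sinh).div (sqrt_neg_hd h) hs.ne').congr_deriv ?_
    simp only [Sk, Ck, h.not_gt, h.ne, if_false]
    generalize Real.sqrt (-k) = s at *
    obtain rfl : k = - s ^ 2 := by linarith
    field_simp
    ring
  · have e : (fun κ => Sk κ r) =ᶠ[𝓝 k]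
        fun κ => Real.sin (Real.sqrt κ * r) / Real.sqrt κ := by
      filter_upwards [Ioi_mem_nhds h] with κ hκ
      have hκ : 0 < κ := hκ
      simp [Sk, hκ]
    refine HasDerivAt.congr_of_eventuallyEq ?_ e
    have hs : 0 < Real.sqrt k := Real.sqrt_pos.2 h
    have hq : Real.sqrt k ^ 2 = k := Real.sq_sqrt h.le
    refine (((sqrt_hd h r).sin).div (Real.hasDerivAt_sqrt h.ne') hs.ne').congr_deriv ?_
    simp only [Sk, Ck, h, if_true]
    generalize Real.sqrt k = s at *
    obtain rfl : k = s ^ 2 := by linarith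
    field_simp

lemma Ck_hd {k : ℝ} (hk : k ≠ 0) (r : ℝ) :
    HasDerivAt (fun κ => Ck κ r) (-r * Sk k r / 2) k := by
  rcases lt_or_gt_of_ne hk with h | h
  · have e : (fun κ => Ck κ r) =ᶠ[𝓝 k]
        fun κ => Real.cosh (Real.sqrt (-κ) * r) := by
      filter_upwards [Iio_mem_nhds h] with κ hκ
      have hκ : κ < 0 := hκ
      simp [Ck, hκ.not_gt, hκ.ne]
    refine HasDerivAt.congr_of_eventuallyEq ?_ e
    have hs : 0 < Real.sqrt (-k) := Real.sqrt_pos.2 (by linarith)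
    refine (((sqrt_neg_hd h).mul_const r).cosh).congr_deriv ?_
    simp only [Sk, h.not_gt, h.ne, if_false]
    field_simp
  · have e : (fun κ => Ck κ r) =ᶠ[𝓝 k]
        fun κ => Real.cos (Real.sqrt κ * r) := by
      filter_upwards [Ioi_mem_nhds h] with κ hκ
      have hκ : 0 < κ := hκ
      simp [Ck, hκ]
    refine HasDerivAt.congr_of_eventuallyEq ?_ e
    have hs : 0 < Real.sqrt k := Real.sqrt_pos.2 h
    refine ((sqrt_hd h r).cos).congr_deriv ?_
    simp only [Sk, h, if_true]
    field_simp

lemma Sk_hasSum (k r : ℝ) :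
    HasSum (fun n : ℕ => k ^ n * ((-1) ^ n * r ^ (2 * n + 1) / ((2 * n + 1).factorial : ℝ)))
      (Sk k r) := by
  rcases lt_trichotomy k 0 with h | h | h
  · have hs : 0 < Real.sqrt (-k) := Real.sqrt_pos.2 (by linarith)
    have hq : Real.sqrt (-k) ^ 2 = -k := Real.sq_sqrt (by linarith)
    simp only [Sk, h.not_gt, h.ne, if_false]
    convert! (Real.hasSum_sinh (Real.sqrt (-k) * r)).div_const (Real.sqrt (-k)) using 2 with n
    rw [mul_pow, pow_succ (Real.sqrt (-k)), pow_mul (Real.sqrt (-k)), hq, neg_pow k]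
    field_simp
  · subst h
    convert! hasSum_single (α := ℝ) 0 ?_ using 1
    · simp [Sk]
    · intro n hn
      simp [hn]
  · have hs : 0 < Real.sqrt k := Real.sqrt_pos.2 h
    have hq : Real.sqrt k ^ 2 = k := Real.sq_sqrt h.le
    simp only [Sk, h, if_true]
    convert! (Real.hasSum_sin (Real.sqrt k * r)).div_const (Real.sqrt k) using 2 with n
    rw [mul_pow, pow_succ (Real.sqrt k), pow_mul (Real.sqrt k), hq]
    field_simp

lemma Sk_fps (r : ℝ) : HasFPowerSeriesAt (fun κ => Sk κ r)
    (FormalMultilinearSeries.ofScalars ℝ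
      (fun n : ℕ => (-1) ^ n * r ^ (2 * n + 1) / ((2 * n + 1).factorial : ℝ))) 0 := by
  rw [hasFPowerSeriesAt_iff]
  refine Filter.Eventually.of_forall fun z => ?_
  simpa [FormalMultilinearSeries.coeff_ofScalars] using Sk_hasSum z r

/-- For `k ≠ 0`: `∂²_k S_k(r) = (1/(4k²))(−3 r C_k(r) + (3 − k r²) S_k(r))`;
moreover `∂²_k S_k(r) → r⁵/60` as `k → 0`. -/
theorem stmt_18 :
    (∀ k : ℝ, k ≠ 0 → ∀ r : ℝ,
      HasDerivAt (fun κ => deriv (fun κ' => Sk κ' r) κ)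
        ((1 / (4 * k ^ 2)) * (-3 * r * Ck k r + (3 - k * r ^ 2) * Sk k r)) k) ∧
    (∀ r : ℝ,
      Tendsto (fun k : ℝ => deriv (fun κ => deriv (fun κ' => Sk κ' r) κ) k)
        (nhdsWithin 0 {0}ᶜ) (nhds (r ^ 5 / 60))) := by
  refine ⟨fun k hk r => ?_, fun r => ?_⟩
  · have e : (fun κ => deriv (fun κ' => Sk κ' r) κ) =ᶠ[𝓝 k]
        fun κ => (r * Ck κ r - Sk κ r) / (2 * κ) := by
      filter_upwards [isOpen_ne.mem_nhds hk] with κ hκ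
      exact (Sk_hd hκ r).deriv
    refine HasDerivAt.congr_of_eventuallyEq ?_ e
    refine ((((Ck_hd hk r).const_mul r).sub (Sk_hd hk r)).div
      ((hasDerivAt_id k).const_mul 2) (by simpa using hk)).congr_deriv ?_
    simp only [Pi.sub_apply, id]
    field_simp
    ring
  · have ha : AnalyticAt ℝ (fun κ => Sk κ r) 0 := ⟨_, Sk_fps r⟩
    have hc : deriv (deriv (fun κ => Sk κ r)) 0 = r ^ 5 / 60 := by
      have h1 := ha.hasFPowerSeriesAt.eq_formalMultilinearSeries (Sk_fps r)
      have h2 := congrArg (fun p => FormalMultilinearSeries.coeff p 2) h1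
      simp only [FormalMultilinearSeries.coeff_ofScalars, iteratedDeriv_succ,
        iteratedDeriv_zero] at h2
      norm_num [Nat.factorial] at h2
      linarith
    rw [← hc]
    exact ha.deriv.deriv.continuousAt.tendsto.mono_left nhdsWithin_le_nhds
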